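/- Suppose Σ_{r∈Σ_R} p_r K_r^{−1} < 1 (which implies η < 1 since α_min < 1), and let μ_p be the unique absolutely continuous stationary probability measure for F. Then there exists a constant a > 0 such that dμ_p/dλ(x) ≤ a·x^{−α_min} for all x ∈ (0,1]. -/

import Mathlib

open MeasureTheory Set

/-- Left branch of the LSV-type maps: `x ↦ x(1 + 2^α x^α)`. -/
noncomputable def lsvLeft (α x : ℝ) : ℝ := x * (1 + 2 ^ α * x ^ α)

/-- The LSV map `S_α`. -/
noncomputable def lsvMap (α : ℝ) (x : ℝ) : ℝ :=
  if x ≤ 1 / 2 then lsvLeft α x else 2 * x - 1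

/-- The map `R_{α,K}`. -/
noncomputable def rMap (α K : ℝ) (x : ℝ) : ℝ :=
  if x ≤ 1 / 2 then lsvLeft α x
  else 1 / 2 + K * (x - 1 / 2) + 2 * (1 - K) * (x - 1 / 2) ^ 2

section

open scoped ENNReal

/-- A monotone inverse of a strictly increasing continuous function on an interval. -/
theorem exists_monotone_inverse {a b : ℝ} (hab : a ≤ b) {L : ℝ → ℝ}
    (hc : ContinuousOn L (Icc a b)) (hm : StrictMonoOn L (Icc a b)) :
    ∃ Y : ℝ → ℝ, Monotone Y ∧ (∀ u ∈ Ioc a b, Y (L u) = u) ∧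
      ∀ x ∈ Ioc (L a) (L b), Y x ∈ Ioc a b ∧ L (Y x) = x := by
  have hLab : L a ≤ L b := hm.monotoneOn (left_mem_Icc.2 hab) (right_mem_Icc.2 hab) hab
  have hex : ∀ x : ℝ, ∃ u ∈ Icc a b, L u = max (L a) (min x (L b)) := fun x =>
    intermediate_value_Icc hab hc ⟨le_max_left _ _, max_le hLab (min_le_right _ _)⟩
  choose Y hY hLY using hex
  refine ⟨Y, fun x y hxy => ?_, fun u hu => ?_, fun x hx => ?_⟩
  · rw [← hm.le_iff_le (hY x) (hY y), hLY, hLY]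
    gcongr
  · have hu' : u ∈ Icc a b := Ioc_subset_Icc_self hu
    apply hm.injOn (hY _) hu'
    rw [hLY, min_eq_left (hm.monotoneOn hu' (right_mem_Icc.2 hab) hu.2),
      max_eq_right (hm.monotoneOn (left_mem_Icc.2 hab) hu' hu.1.le)]
  · have h : L (Y x) = x := by rw [hLY, min_eq_left hx.2, max_eq_right hx.1.le]
    refine ⟨⟨lt_of_le_of_ne (hY x).1 ?_, (hY x).2⟩, h⟩
    rintro h'
    rw [← h'] at h
    exact hx.1.ne h

/-- An increasing differentiable branch `L : (a, b] → (L a, L b]` with nondecreasing positive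
derivative `D` and monotone inverse `Y`. -/
structure Branch where
  a : ℝ
  b : ℝ
  L : ℝ → ℝ
  D : ℝ → ℝ
  Y : ℝ → ℝ
  L_meas : Measurable L
  D_meas : Measurable D
  hasDeriv : ∀ u ∈ Ioc a b, HasDerivAt L (D u) u
  D_pos : ∀ u ∈ Ioc a b, 0 < D u
  D_mono : MonotoneOn D (Ioc a b)
  Y_mono : Monotone Y
  L_mem : ∀ u ∈ Ioc a b, L u ∈ Ioc (L a) (L b)
  Y_L : ∀ u ∈ Ioc a b, Y (L u) = u
  Y_mem : ∀ x ∈ Ioc (L a) (L b), Y x ∈ Ioc a b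
  L_Y : ∀ x ∈ Ioc (L a) (L b), L (Y x) = x

namespace Branch

/-- Build a branch from a function with positive nondecreasing derivative. -/
noncomputable def ofDeriv (a b : ℝ) (hab : a < b) (L D : ℝ → ℝ) (hLm : Measurable L)
    (hDm : Measurable D) (hL : ContinuousOn L (Icc a b))
    (hd : ∀ u ∈ Ioc a b, HasDerivAt L (D u) u) (hpos : ∀ u ∈ Ioc a b, 0 < D u)
    (hmono : MonotoneOn D (Ioc a b)) : Branch :=
  have hm : StrictMonoOn L (Icc a b) := by
    refine strictMonoOn_of_deriv_pos (convex_Icc a b) hL fun u hu => ?_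
    rw [interior_Icc] at hu
    rw [(hd u (Ioo_subset_Ioc_self hu)).deriv]
    exact hpos u (Ioo_subset_Ioc_self hu)
  have hex := exists_monotone_inverse hab.le hL hm
  { a := a, b := b, L := L, D := D, Y := hex.choose
    L_meas := hLm
    D_meas := hDm
    hasDeriv := hd
    D_pos := hpos
    D_mono := hmono
    Y_mono := hex.choose_spec.1
    L_mem := fun u hu => ⟨hm (left_mem_Icc.2 hab.le) (Ioc_subset_Icc_self hu) hu.1,
      hm.monotoneOn (Ioc_subset_Icc_self hu) (right_mem_Icc.2 hab.le) hu.2⟩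
    Y_L := hex.choose_spec.2.1
    Y_mem := fun x hx => (hex.choose_spec.2.2 x hx).1
    L_Y := fun x hx => (hex.choose_spec.2.2 x hx).2 }

/-- The transfer operator of a single branch. -/
noncomputable def op (β : Branch) (f : ℝ → ℝ≥0∞) : ℝ → ℝ≥0∞ :=
  (Ioc (β.L β.a) (β.L β.b)).indicator fun x => f (β.Y x) * ENNReal.ofReal (β.D (β.Y x))⁻¹

variable (β : Branch)

theorem op_of_mem {f : ℝ → ℝ≥0∞} {x : ℝ} (hx : x ∈ Ioc (β.L β.a) (β.L β.b)) :
    β.op f x = f (β.Y x) * ENNReal.ofReal (β.D (β.Y x))⁻¹ := indicator_of_mem hx _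

theorem op_of_notMem {f : ℝ → ℝ≥0∞} {x : ℝ} (hx : x ∉ Ioc (β.L β.a) (β.L β.b)) :
    β.op f x = 0 := indicator_of_notMem hx _

theorem measurable_op {f : ℝ → ℝ≥0∞} (hf : Measurable f) : Measurable (β.op f) :=
  ((hf.comp β.Y_mono.measurable).mul
    (β.D_meas.comp β.Y_mono.measurable).inv.ennreal_ofReal).indicator measurableSet_Ioc

theorem op_add (f g : ℝ → ℝ≥0∞) (x : ℝ) : β.op (fun y => f y + g y) x = β.op f x + β.op g x := by
  by_cases hx : x ∈ Ioc (β.L β.a) (β.L β.b)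
  · simp only [β.op_of_mem hx, add_mul]
  · simp only [β.op_of_notMem hx, add_zero]

theorem op_mono {f g : ℝ → ℝ≥0∞} (h : ∀ u ∈ Ioc β.a β.b, f u ≤ g u) (x : ℝ) :
    β.op f x ≤ β.op g x := by
  by_cases hx : x ∈ Ioc (β.L β.a) (β.L β.b)
  · rw [β.op_of_mem hx, β.op_of_mem hx]
    gcongr
    exact h _ (β.Y_mem x hx)
  · simp only [β.op_of_notMem hx, le_refl]

theorem antitoneOn_op {f : ℝ → ℝ≥0∞} (hf : AntitoneOn f (Ioc β.a β.b)) :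
    AntitoneOn (β.op f) (Ioc (β.L β.a) (β.L β.b)) := by
  intro x hx y hy hxy
  rw [β.op_of_mem hx, β.op_of_mem hy]
  have hx' := β.Y_mem x hx
  have hy' := β.Y_mem y hy
  have h := β.Y_mono hxy
  have := β.D_pos _ hx'
  have := β.D_mono hx' hy' h
  gcongr
  exact hf hx' hy' h

theorem lintegral_op (f : ℝ → ℝ≥0∞) {E : Set ℝ} (hE : MeasurableSet E) :
    ∫⁻ x in E, β.op f x = ∫⁻ u in Ioc β.a β.b ∩ β.L ⁻¹' E, f u := by
  have himage : β.L '' (Ioc β.a β.b ∩ β.L ⁻¹' E) = Ioc (β.L β.a) (β.L β.b) ∩ E := by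
    ext x
    constructor
    · rintro ⟨u, ⟨hu, huE⟩, rfl⟩
      exact ⟨β.L_mem u hu, huE⟩
    · rintro ⟨hx, hxE⟩
      refine ⟨β.Y x, ⟨β.Y_mem x hx, ?_⟩, β.L_Y x hx⟩
      rw [mem_preimage, β.L_Y x hx]
      exact hxE
  have hs : MeasurableSet (Ioc β.a β.b ∩ β.L ⁻¹' E) := measurableSet_Ioc.inter (β.L_meas hE)
  have hinj : InjOn β.L (Ioc β.a β.b ∩ β.L ⁻¹' E) := by
    intro u hu v hv huv
    rw [← β.Y_L u hu.1, ← β.Y_L v hv.1, huv]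
  unfold op
  rw [setLIntegral_indicator measurableSet_Ioc, ← himage,
    lintegral_image_eq_lintegral_abs_deriv_mul hs
      (fun u hu => (β.hasDeriv u hu.1).hasDerivWithinAt) hinj]
  refine setLIntegral_congr_fun hs fun u hu => ?_
  have hpos := β.D_pos u hu.1
  simp only [β.Y_L u hu.1, abs_of_pos hpos]
  rw [mul_comm (f u), ← mul_assoc, ← ENNReal.ofReal_mul hpos.le, mul_inv_cancel₀ hpos.ne',
    ENNReal.ofReal_one, one_mul]

end Branch

theorem hasDerivAt_lsvLeft (α : ℝ) {u : ℝ} (hu : 0 < u) :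
    HasDerivAt (lsvLeft α) (1 + (1 + α) * (2 ^ α * u ^ α)) u := by
  have h := (hasDerivAt_id u).mul
    (((Real.hasDerivAt_rpow_const (p := α) (Or.inl hu.ne')).const_mul ((2 : ℝ) ^ α)).const_add 1)
  have hpow : u * u ^ (α - 1) = u ^ α := by
    rw [Real.rpow_sub_one hu.ne']
    field_simp
  refine h.congr_deriv ?_
  simp only [id]
  linear_combination (2 ^ α * α) * hpow

theorem two_rpow_mul_rpow {α : ℝ} {u : ℝ} (hu : 0 ≤ u) :
    (2 : ℝ) ^ α * u ^ α = (2 * u) ^ α := (Real.mul_rpow two_pos.le hu).symm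

theorem lsvLeft_zero (α : ℝ) : lsvLeft α 0 = 0 := by simp [lsvLeft]

theorem lsvLeft_half (α : ℝ) : lsvLeft α (1 / 2) = 1 := by
  rw [lsvLeft, two_rpow_mul_rpow (by norm_num)]
  norm_num

/-- The left branch shared by the maps `S_α` and `R_{α,K}`. -/
noncomputable def leftBranch (α : ℝ) (hα : 0 < α) : Branch :=
  Branch.ofDeriv 0 (1 / 2) (by norm_num) (lsvLeft α) (fun u => 1 + (1 + α) * (2 ^ α * u ^ α))
    (by unfold lsvLeft; fun_prop) (by fun_prop)
    (by
      unfold lsvLeft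
      exact (continuous_id.mul (continuous_const.add (continuous_const.mul
        (Real.continuous_rpow_const hα.le)))).continuousOn)
    (fun u hu => hasDerivAt_lsvLeft α hu.1)
    (fun u hu => by have := hu.1; positivity)
    (fun u hu v hv huv => by
      have := hu.1
      have : u ^ α ≤ v ^ α := by gcongr
      dsimp only
      gcongr)

/-- The right branch of the maps `S_α`. -/
noncomputable def doublingBranch : Branch :=
  Branch.ofDeriv (1 / 2) 1 (by norm_num) (fun x => 2 * x - 1) (fun _ => 2)
    (by fun_prop) (by fun_prop) (by fun_prop)
    (fun u _ => by simpa using ((hasDerivAt_id u).const_mul 2).sub_const 1)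
    (fun _ _ => two_pos) (fun _ _ _ _ _ => le_rfl)

/-- The right branch of the maps `R_{α,K}`. -/
noncomputable def contractingBranch (K : ℝ) (hK : K ∈ Ioo (0 : ℝ) 1) : Branch :=
  Branch.ofDeriv (1 / 2) 1 (by norm_num)
    (fun x => 1 / 2 + K * (x - 1 / 2) + 2 * (1 - K) * (x - 1 / 2) ^ 2)
    (fun x => K + 4 * (1 - K) * (x - 1 / 2))
    (by fun_prop) (by fun_prop) (by fun_prop)
    (fun u _ => by
      have h := (hasDerivAt_id u).sub_const (1 / 2)
      refine (((h.const_mul K).const_add (1 / 2)).add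
        ((h.pow 2).const_mul (2 * (1 - K)))).congr_deriv ?_
      simp only [id]
      ring)
    (fun u hu => by nlinarith [hu.1, hK.1, hK.2])
    (fun u _ v _ huv => by
      have := hK.2
      dsimp only
      gcongr)

/-- The data of a random system: probabilities `p`, exponents `α`, right branches, and bounds `q`
for the reciprocal slopes of the right branches mapping `(1/2, 1]` to itself. -/
structure BranchSystem (ι : Type*) [Fintype ι] where
  p : ι → ℝ
  α : ι → ℝ
  q : ι → ℝ
  right : ι → Branch
  αmin : ℝ
  p_pos : ∀ j, 0 < p j
  p_sum : ∑ j, p j = 1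
  α_pos : ∀ j, 0 < α j
  q_nonneg : ∀ j, 0 ≤ q j
  sum_lt_one : ∑ j, p j * q j < 1
  right_spec : ∀ j, right j = doublingBranch ∨
    ∃ (K : ℝ) (hK : K ∈ Ioo (0 : ℝ) 1), q j = K⁻¹ ∧ right j = contractingBranch K hK
  exists_full : ∃ j, right j = doublingBranch
  isLeast_αmin : IsLeast (range α) αmin
  αmin_lt_one : αmin < 1

/-- If `x = u (1 + t)` with `t = (2u)^α'`, the function `x ^ (-α)` transported along the left branch
with exponent `α' ≥ α` decreases by a definite amount. -/
theorem rpow_div_deriv_le {α α' u : ℝ} (hα : 0 < α) (hα1 : α < 1) (hαα' : α ≤ α')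
    (hu : u ∈ Ioc (0 : ℝ) (1 / 2)) :
    u ^ (-α) * (1 + (1 + α') * (2 ^ α' * u ^ α'))⁻¹ ≤
      (lsvLeft α' u) ^ (-α) * (1 - (2 ^ α' * u ^ α') / (2 + α')) := by
  have hu0 := hu.1
  have ht0 : 0 < (2 : ℝ) ^ α' * u ^ α' := by positivity
  have ht1 : (2 : ℝ) ^ α' * u ^ α' ≤ 1 := by
    rw [two_rpow_mul_rpow hu0.le]
    exact Real.rpow_le_one (by linarith) (by linarith [hu.2]) (by linarith)
  unfold lsvLeft
  set t := (2 : ℝ) ^ α' * u ^ α'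
  have hpow : (u * (1 + t)) ^ (-α) * (1 + t) ^ α = u ^ (-α) := by
    rw [Real.mul_rpow hu0.le (by positivity), mul_assoc, ← Real.rpow_add (by positivity)]
    simp
  have hbern : (1 + t) ^ α ≤ 1 + α * t :=
    rpow_one_add_le_one_add_mul_self (by linarith) hα.le hα1.le
  have hpos : 0 < (u * (1 + t)) ^ (-α) := by positivity
  rw [← hpow, mul_assoc]
  refine mul_le_mul_of_nonneg_left ?_ hpos.le
  have hD : 0 < 1 + (1 + α') * t := by nlinarith
  rw [← div_eq_mul_inv, div_le_iff₀ hD]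
  have h2 : 0 < 2 + α' := by linarith
  have hs : t / (2 + α') * (1 + (1 + α') * t) ≤ t := by
    rw [div_mul_eq_mul_div, div_le_iff₀ h2]
    exact mul_le_mul_of_nonneg_left
      (by nlinarith [mul_nonneg (by linarith : (0 : ℝ) ≤ 1 + α') (sub_nonneg.2 ht1)]) ht0.le
  nlinarith

namespace BranchSystem

variable {ι : Type*} [Fintype ι] (s : BranchSystem ι)

/-- The left branch of the `j`-th map. -/
noncomputable def left (j : ι) : Branch := leftBranch (s.α j) (s.α_pos j)

/-- The averaged transfer operator. -/
noncomputable def op (f : ℝ → ℝ≥0∞) : ℝ → ℝ≥0∞ := fun x =>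
  ∑ j, ENNReal.ofReal (s.p j) * ((s.left j).op f x + (s.right j).op f x)

theorem left_a (j : ι) : (s.left j).a = 0 := rfl

theorem left_b (j : ι) : (s.left j).b = 1 / 2 := rfl

theorem left_L (j : ι) : (s.left j).L = lsvLeft (s.α j) := rfl

theorem left_D (j : ι) :
    (s.left j).D = fun u => 1 + (1 + s.α j) * (2 ^ s.α j * u ^ s.α j) := rfl

theorem left_range (j : ι) :
    Ioc ((s.left j).L (s.left j).a) ((s.left j).L (s.left j).b) = Ioc 0 1 := by
  rw [left_L, left_a, left_b, lsvLeft_zero, lsvLeft_half]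

theorem doublingBranch_range :
    Ioc (doublingBranch.L doublingBranch.a) (doublingBranch.L doublingBranch.b) = Ioc 0 1 := by
  change Ioc (2 * (1 / 2 : ℝ) - 1) (2 * 1 - 1) = _
  norm_num

theorem contractingBranch_range (K : ℝ) (hK : K ∈ Ioo (0 : ℝ) 1) :
    Ioc ((contractingBranch K hK).L (contractingBranch K hK).a)
      ((contractingBranch K hK).L (contractingBranch K hK).b) = Ioc (1 / 2) 1 := by
  change Ioc (1 / 2 + K * (1 / 2 - 1 / 2) + 2 * (1 - K) * (1 / 2 - 1 / 2) ^ 2 : ℝ)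
    (1 / 2 + K * (1 - 1 / 2) + 2 * (1 - K) * (1 - 1 / 2) ^ 2) = _
  congr 1 <;> ring

theorem doublingBranch_op {f : ℝ → ℝ≥0∞} {x : ℝ} (hx : x ∈ Ioc (0 : ℝ) 1) :
    doublingBranch.op f x = f ((x + 1) / 2) * ENNReal.ofReal 2⁻¹ := by
  rw [← doublingBranch_range] at hx
  have h : 2 * doublingBranch.Y x - 1 = x := doublingBranch.L_Y x hx
  have hY : doublingBranch.Y x = (x + 1) / 2 := by linarith
  rw [Branch.op_of_mem _ hx, hY]
  rfl

theorem right_a (j : ι) : (s.right j).a = 1 / 2 := by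
  rcases s.right_spec j with h | ⟨K, hK, -, h⟩ <;> rw [h] <;> rfl

theorem right_b (j : ι) : (s.right j).b = 1 := by
  rcases s.right_spec j with h | ⟨K, hK, -, h⟩ <;> rw [h] <;> rfl

theorem right_range_subset (j : ι) :
    Ioc ((s.right j).L (s.right j).a) ((s.right j).L (s.right j).b) ⊆ Ioc 0 1 := by
  rcases s.right_spec j with h | ⟨K, hK, -, h⟩ <;> rw [h]
  · rw [doublingBranch_range]
  · rw [contractingBranch_range]
    exact Ioc_subset_Ioc_left (by norm_num)

theorem sum_ofReal_p : ∑ j, ENNReal.ofReal (s.p j) = 1 := by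
  rw [← ENNReal.ofReal_sum_of_nonneg fun i _ => (s.p_pos i).le, s.p_sum, ENNReal.ofReal_one]

theorem αmin_pos : 0 < s.αmin := by
  obtain ⟨j, hj⟩ := s.isLeast_αmin.1
  exact hj ▸ s.α_pos j

theorem αmin_le (j : ι) : s.αmin ≤ s.α j := s.isLeast_αmin.2 (mem_range_self j)

theorem left_mem {j : ι} {x : ℝ} (hx : x ∈ Ioc (0 : ℝ) 1) :
    (s.left j).Y x ∈ Ioc (0 : ℝ) (1 / 2) :=
  (s.left j).Y_mem x (by rwa [left_range])

theorem lsvLeft_left_Y {j : ι} {x : ℝ} (hx : x ∈ Ioc (0 : ℝ) 1) :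
    lsvLeft (s.α j) ((s.left j).Y x) = x :=
  (s.left j).L_Y x (by rwa [left_range])

theorem left_op {j : ι} {f : ℝ → ℝ≥0∞} {x : ℝ} (hx : x ∈ Ioc (0 : ℝ) 1) :
    (s.left j).op f x =
      f ((s.left j).Y x) * ENNReal.ofReal ((s.left j).D ((s.left j).Y x))⁻¹ :=
  (s.left j).op_of_mem (by rwa [left_range])

theorem one_le_left_D {j : ι} {u : ℝ} (hu : 0 < u) : 1 ≤ (s.left j).D u := by
  have := s.α_pos j
  rw [left_D]
  have : 0 < (1 + s.α j) * (2 ^ s.α j * u ^ s.α j) := by positivity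
  linarith

theorem left_D_le {j : ι} {u : ℝ} (hu : u ∈ Ioc (0 : ℝ) (1 / 2)) :
    (s.left j).D u ≤ 2 + s.α j := by
  have hα := s.α_pos j
  simp only [left_D]
  rw [two_rpow_mul_rpow hu.1.le]
  have : (2 * u) ^ s.α j ≤ 1 :=
    Real.rpow_le_one (by linarith [hu.1]) (by linarith [hu.2]) hα.le
  nlinarith

theorem left_Y_le {j : ι} {x : ℝ} (hx : x ∈ Ioc (0 : ℝ) 1) : (s.left j).Y x ≤ x := by
  have hu := (s.left_mem (j := j) hx).1
  have h := s.lsvLeft_left_Y (j := j) hx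
  rw [lsvLeft] at h
  have : 0 < (s.left j).Y x * (2 ^ s.α j * (s.left j).Y x ^ s.α j) := by positivity
  linarith

theorem quarter_le_left_Y {j : ι} {x : ℝ} (hx : x ∈ Ioc (1 / 2 : ℝ) 1) :
    1 / 4 ≤ (s.left j).Y x := by
  have hx' : x ∈ Ioc (0 : ℝ) 1 := ⟨by linarith [hx.1], hx.2⟩
  have hu := s.left_mem (j := j) hx'
  have h := s.lsvLeft_left_Y (j := j) hx'
  rw [lsvLeft, two_rpow_mul_rpow hu.1.le] at h
  have : (2 * (s.left j).Y x) ^ s.α j ≤ 1 :=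
    Real.rpow_le_one (by linarith [hu.1]) (by linarith [hu.2]) (s.α_pos j).le
  nlinarith [hu.1, hx.1]

theorem op_of_notMem {f : ℝ → ℝ≥0∞} {x : ℝ} (hx : x ∉ Ioc (0 : ℝ) 1) : s.op f x = 0 := by
  refine Finset.sum_eq_zero fun j _ => ?_
  rw [Branch.op_of_notMem _ (by rwa [left_range]),
    Branch.op_of_notMem _ fun h => hx (s.right_range_subset j h), add_zero, mul_zero]

theorem measurable_op {f : ℝ → ℝ≥0∞} (hf : Measurable f) : Measurable (s.op f) :=
  Finset.measurable_sum _ fun j _ =>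
    (((s.left j).measurable_op hf).add ((s.right j).measurable_op hf)).const_mul _

theorem op_add (f g : ℝ → ℝ≥0∞) : s.op (fun y => f y + g y) = fun x => s.op f x + s.op g x := by
  ext x
  simp only [op, Branch.op_add, ← Finset.sum_add_distrib, ← mul_add]
  congr! 2
  ring

theorem op_mono {f g : ℝ → ℝ≥0∞} (h : ∀ u ∈ Ioc (0 : ℝ) 1, f u ≤ g u) (x : ℝ) :
    s.op f x ≤ s.op g x := by
  refine Finset.sum_le_sum fun j _ => ?_
  gcongr
  · refine Branch.op_mono _ (fun u hu => h u ?_) x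
    rw [left_a, left_b] at hu
    exact ⟨hu.1, by linarith [hu.2]⟩
  · refine Branch.op_mono _ (fun u hu => h u ?_) x
    rw [right_a, right_b] at hu
    exact ⟨by linarith [hu.1], hu.2⟩

theorem setLIntegral_op {f : ℝ → ℝ≥0∞} (hf : Measurable f) {E : Set ℝ} (hE : MeasurableSet E) :
    ∫⁻ x in E, s.op f x = ∑ j, ENNReal.ofReal (s.p j) *
      ((∫⁻ u in Ioc 0 (1 / 2) ∩ lsvLeft (s.α j) ⁻¹' E, f u) +
        ∫⁻ u in Ioc (1 / 2) 1 ∩ (s.right j).L ⁻¹' E, f u) := by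
  have hm : ∀ j, Measurable fun x => (s.left j).op f x + (s.right j).op f x := fun j =>
    ((s.left j).measurable_op hf).add ((s.right j).measurable_op hf)
  unfold op
  rw [lintegral_finsetSum _ fun j _ => (hm j).const_mul _]
  congr! 1 with j
  rw [lintegral_const_mul _ (hm j),
    lintegral_add_left ((s.left j).measurable_op hf), Branch.lintegral_op _ _ hE,
    Branch.lintegral_op _ _ hE, left_a, left_b, left_L, right_a, right_b]

theorem lintegral_op {f : ℝ → ℝ≥0∞} (hf : Measurable f) :
    ∫⁻ x in Ioc 0 1, s.op f x = ∫⁻ x in Ioc 0 1, f x := by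
  have hsupp : ∫⁻ x in Ioc 0 1, s.op f x = ∫⁻ x in univ, s.op f x := by
    rw [setLIntegral_univ, ← lintegral_indicator measurableSet_Ioc]
    congr 1
    ext x
    by_cases hx : x ∈ Ioc (0 : ℝ) 1
    · rw [indicator_of_mem hx]
    · rw [indicator_of_notMem hx, s.op_of_notMem hx]
  rw [hsupp, s.setLIntegral_op hf MeasurableSet.univ]
  simp only [preimage_univ, inter_univ]
  rw [← Finset.sum_mul, s.sum_ofReal_p, one_mul,
    ← lintegral_union measurableSet_Ioc (Ioc_disjoint_Ioc_of_le le_rfl),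
    Ioc_union_Ioc_eq_Ioc (by norm_num) (by norm_num)]

theorem measurable_iterate_op {f : ℝ → ℝ≥0∞} (hf : Measurable f) (n : ℕ) :
    Measurable (s.op^[n] f) := by
  induction n with
  | zero => exact hf
  | succ n ih => rw [Function.iterate_succ_apply']; exact s.measurable_op ih

theorem lintegral_iterate_op {f : ℝ → ℝ≥0∞} (hf : Measurable f) (n : ℕ) :
    ∫⁻ x in Ioc 0 1, s.op^[n] f x = ∫⁻ x in Ioc 0 1, f x := by
  induction n with
  | zero => rfl
  | succ n ih =>
    rw [Function.iterate_succ_apply', s.lintegral_op (s.measurable_iterate_op hf n), ih]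

theorem iterate_op_add (f g : ℝ → ℝ≥0∞) (n : ℕ) :
    s.op^[n] (fun y => f y + g y) = fun x => s.op^[n] f x + s.op^[n] g x := by
  induction n with
  | zero => rfl
  | succ n ih => simp only [Function.iterate_succ_apply', ih, s.op_add]

theorem iterate_op_mono {f g : ℝ → ℝ≥0∞} (h : ∀ u ∈ Ioc (0 : ℝ) 1, f u ≤ g u) (n : ℕ) :
    ∀ x ∈ Ioc (0 : ℝ) 1, s.op^[n] f x ≤ s.op^[n] g x := by
  induction n with
  | zero => exact h
  | succ n ih =>
    intro x _
    simp only [Function.iterate_succ_apply']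
    exact s.op_mono ih x

theorem iterate_op_congr {f g : ℝ → ℝ≥0∞} (h : ∀ u ∈ Ioc (0 : ℝ) 1, f u = g u) (n : ℕ) :
    ∀ x ∈ Ioc (0 : ℝ) 1, s.op^[n] f x = s.op^[n] g x := fun x hx =>
  le_antisymm (s.iterate_op_mono (fun u hu => (h u hu).le) n x hx)
    (s.iterate_op_mono (fun u hu => (h u hu).ge) n x hx)

/-- If `f` is a fixed point of the transfer operator almost everywhere, so are its images. -/
theorem iterate_op_ae_eq {f : ℝ → ℝ≥0∞} (hf : Measurable f)
    (hfix : ∀ᵐ x ∂volume.restrict (Ioc 0 1), f x = s.op f x) (n : ℕ) :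
    ∀ᵐ x ∂volume.restrict (Ioc 0 1), f x ≤ s.op^[n] f x := by
  induction n with
  | zero => exact Filter.Eventually.of_forall fun _ => le_rfl
  | succ n ih =>
    have hm := s.measurable_iterate_op hf n
    have he : Measurable fun x => f x - s.op^[n] f x := hf.sub hm
    have hzero : ∫⁻ x in Ioc 0 1, s.op (fun x => f x - s.op^[n] f x) x = 0 := by
      rw [s.lintegral_op he, lintegral_eq_zero_iff he]
      filter_upwards [ih] with x hx using tsub_eq_zero_of_le hx
    rw [lintegral_eq_zero_iff (s.measurable_op he)] at hzero
    filter_upwards [hfix, hzero] with x hx hx0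
    rw [Function.iterate_succ_apply', hx]
    calc s.op f x ≤ s.op (fun x => s.op^[n] f x + (f x - s.op^[n] f x)) x :=
          s.op_mono (fun u _ => le_add_tsub) x
      _ = s.op (s.op^[n] f) x := by
          rw [s.op_add]
          simp only [Pi.zero_apply] at hx0
          simp only [hx0, add_zero]

/-- The amount by which `x ^ (-αmin)` is decreased by the left branches. -/
theorem exists_gap : ∃ γ > (0 : ℝ), ∀ x ∈ Ioc (0 : ℝ) 1,
    ∑ j, s.p j * ((s.left j).Y x ^ (-s.αmin) * ((s.left j).D ((s.left j).Y x))⁻¹) ≤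
      x ^ (-s.αmin) - γ := by
  classical
  obtain ⟨i, hi⟩ := s.isLeast_αmin.1
  have hα := s.αmin_pos
  have hpi := s.p_pos i
  refine ⟨s.p i * (1 / (2 + s.αmin)), by positivity, fun x hx => ?_⟩
  have hterm : ∀ j, (s.left j).Y x ^ (-s.αmin) * ((s.left j).D ((s.left j).Y x))⁻¹ ≤
      x ^ (-s.αmin) - if j = i then 1 / (2 + s.αmin) else 0 := by
    intro j
    have hu := s.left_mem (j := j) hx
    have hαj := s.α_pos j
    have h := rpow_div_deriv_le hα s.αmin_lt_one (s.αmin_le j) hu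
    rw [s.lsvLeft_left_Y hx] at h
    refine h.trans ?_
    have hx0 : 0 < x ^ (-s.αmin) := Real.rpow_pos_of_pos hx.1 _
    have hu0 := hu.1
    rw [mul_sub, mul_one]
    gcongr
    split_ifs with hji
    · subst hji
      have hle : x ≤ 2 * (s.left j).Y x := by
        have h1 := s.lsvLeft_left_Y (j := j) hx
        rw [lsvLeft, two_rpow_mul_rpow hu0.le] at h1
        have : (2 * (s.left j).Y x) ^ s.α j ≤ 1 :=
          Real.rpow_le_one (by linarith) (by linarith [hu.2]) hαj.le
        nlinarith
      rw [hi, two_rpow_mul_rpow hu0.le, ← mul_div_assoc]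
      gcongr
      calc (1 : ℝ) = x ^ (-s.αmin) * x ^ s.αmin := by
            rw [← Real.rpow_add hx.1]; simp
        _ ≤ _ := by
            have := hx.1
            gcongr
    · positivity
  calc _ ≤ ∑ j, s.p j * (x ^ (-s.αmin) - if j = i then 1 / (2 + s.αmin) else 0) :=
        Finset.sum_le_sum fun j _ => mul_le_mul_of_nonneg_left (hterm j) (s.p_pos j).le
    _ = _ := by
        simp only [mul_sub, Finset.sum_sub_distrib, ← Finset.sum_mul, s.p_sum, one_mul, mul_ite,
          mul_zero, Finset.sum_ite_eq', Finset.mem_univ, if_true]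

theorem _root_.AntitoneOn.mul_sub_le_setLIntegral {f : ℝ → ℝ≥0∞} {a b x : ℝ}
    (hf : AntitoneOn f (Ioc a b)) (hx : x ∈ Ioc a b) {S : Set ℝ} (hS : Ioc a b ⊆ S) :
    f x * ENNReal.ofReal (x - a) ≤ ∫⁻ u in S, f u := by
  calc f x * ENNReal.ofReal (x - a) = ∫⁻ _ in Ioc a x, f x := by
        rw [setLIntegral_const, Real.volume_Ioc]
    _ ≤ ∫⁻ u in Ioc a x, f u := setLIntegral_mono' measurableSet_Ioc fun u hu =>
        hf ⟨hu.1, hu.2.trans hx.2⟩ hx hu.2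
    _ ≤ _ := lintegral_mono_set ((Ioc_subset_Ioc_right hx.2).trans hS)

/-- Functions that are nonincreasing on both halves of the interval, with prescribed bounds for
their values and their mass. -/
structure Admissible (A B M : ℝ) (f : ℝ → ℝ≥0∞) : Prop where
  meas : Measurable f
  anti_left : AntitoneOn f (Ioc 0 (1 / 2))
  anti_right : AntitoneOn f (Ioc (1 / 2) 1)
  le_left : ∀ x ∈ Ioc (0 : ℝ) (1 / 2), f x ≤ ENNReal.ofReal (A * x ^ (-s.αmin))
  le_right : ∀ x ∈ Ioc (1 / 2 : ℝ) 1, f x ≤ ENNReal.ofReal B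
  mass : ∫⁻ x in Ioc 0 1, f x ≤ ENNReal.ofReal M

variable {s}

namespace Admissible

variable {A B M : ℝ} {f : ℝ → ℝ≥0∞}

theorem le_of_quarter_le (hf : s.Admissible A B M f) {x : ℝ} (hx : x ∈ Icc (1 / 4 : ℝ) (1 / 2)) :
    f x ≤ ENNReal.ofReal (4 * M) := by
  have hx' : x ∈ Ioc (0 : ℝ) (1 / 2) := ⟨by linarith [hx.1], hx.2⟩
  have h := (hf.anti_left.mul_sub_le_setLIntegral hx'
    (Ioc_subset_Ioc_right (by norm_num))).trans hf.mass
  calc f x = f x * ENNReal.ofReal (1 / 4) * ENNReal.ofReal 4 := by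
        rw [mul_assoc, ← ENNReal.ofReal_mul (by norm_num)]; norm_num
    _ ≤ f x * ENNReal.ofReal (x - 0) * ENNReal.ofReal 4 := by
        gcongr
        linarith [hx.1]
    _ ≤ ENNReal.ofReal M * ENNReal.ofReal 4 := by gcongr
    _ = _ := by rw [mul_comm, ← ENNReal.ofReal_mul (by norm_num)]

theorem le_of_three_quarters_le (hf : s.Admissible A B M f) {x : ℝ}
    (hx : x ∈ Icc (3 / 4 : ℝ) 1) : f x ≤ ENNReal.ofReal (4 * M) := by
  have hx' : x ∈ Ioc (1 / 2 : ℝ) 1 := ⟨by linarith [hx.1], hx.2⟩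
  have h := (hf.anti_right.mul_sub_le_setLIntegral hx'
    (Ioc_subset_Ioc_left (by norm_num))).trans hf.mass
  calc f x = f x * ENNReal.ofReal (1 / 4) * ENNReal.ofReal 4 := by
        rw [mul_assoc, ← ENNReal.ofReal_mul (by norm_num)]; norm_num
    _ ≤ f x * ENNReal.ofReal (x - 1 / 2) * ENNReal.ofReal 4 := by
        gcongr
        linarith [hx.1]
    _ ≤ ENNReal.ofReal M * ENNReal.ofReal 4 := by gcongr
    _ = _ := by rw [mul_comm, ← ENNReal.ofReal_mul (by norm_num)]

theorem right_op_le (hf : s.Admissible A B M f) (hB : 0 ≤ B) (hM : 0 ≤ M) (j : ι) {x : ℝ}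
    (hx : x ∈ Ioc (1 / 2 : ℝ) 1) :
    (s.right j).op f x ≤ ENNReal.ofReal (4 * M + s.q j * B) := by
  have hq := s.q_nonneg j
  rcases s.right_spec j with h | ⟨K, hK, hqK, h⟩ <;> rw [h]
  · rw [doublingBranch_op ⟨by linarith [hx.1], hx.2⟩]
    calc _ ≤ ENNReal.ofReal (4 * M) * ENNReal.ofReal 1 := by
          gcongr
          · exact hf.le_of_three_quarters_le ⟨by linarith [hx.1], by linarith [hx.2]⟩
          · norm_num
      _ = ENNReal.ofReal (4 * M) := by simp
      _ ≤ _ := ENNReal.ofReal_le_ofReal (by nlinarith [mul_nonneg hq hB])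
  · have hx' := hx
    rw [← contractingBranch_range K hK] at hx'
    have hY : (contractingBranch K hK).Y x ∈ Ioc (1 / 2 : ℝ) 1 := Branch.Y_mem _ x hx'
    have hD : K ≤ (contractingBranch K hK).D ((contractingBranch K hK).Y x) := by
      change K ≤ K + 4 * (1 - K) * ((contractingBranch K hK).Y x - 1 / 2)
      nlinarith [hY.1, hK.1, hK.2]
    have := hK.1
    rw [Branch.op_of_mem _ hx']
    calc _ ≤ ENNReal.ofReal B * ENNReal.ofReal K⁻¹ := by
          gcongr
          exact hf.le_right _ hY
      _ = ENNReal.ofReal (s.q j * B) := by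
          rw [← ENNReal.ofReal_mul hB, hqK, mul_comm]
      _ ≤ _ := ENNReal.ofReal_le_ofReal (by linarith)

theorem right_op_le_of_le_half (hf : s.Admissible A B M f) (j : ι) {x : ℝ}
    (hx : x ∈ Ioc (0 : ℝ) (1 / 2)) : (s.right j).op f x ≤ ENNReal.ofReal B := by
  rcases s.right_spec j with h | ⟨K, hK, hqK, h⟩ <;> rw [h]
  · rw [doublingBranch_op ⟨hx.1, by linarith [hx.2]⟩]
    calc _ ≤ ENNReal.ofReal B * ENNReal.ofReal 1 := by
          gcongr
          · exact hf.le_right _ ⟨by linarith [hx.1], by linarith [hx.2]⟩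
          · norm_num
      _ = _ := by simp
  · rw [Branch.op_of_notMem]
    · exact zero_le
    · rw [contractingBranch_range]
      exact fun h' => not_lt.2 hx.2 h'.1

theorem antitoneOn_op_of_subset (hf : s.Admissible A B M f) {S : Set ℝ}
    (hS : S = Ioc 0 (1 / 2) ∨ S = Ioc (1 / 2) 1) : AntitoneOn (s.op f) S := by
  have hleft : ∀ j, AntitoneOn ((s.left j).op f) S := by
    intro j
    have h := (s.left j).antitoneOn_op hf.anti_left
    rw [left_range] at h
    refine h.mono ?_
    rcases hS with rfl | rfl
    · exact Ioc_subset_Ioc_right (by norm_num)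
    · exact Ioc_subset_Ioc_left (by norm_num)
  have hright : ∀ j, AntitoneOn ((s.right j).op f) S := by
    intro j
    rcases s.right_spec j with h | ⟨K, hK, -, h⟩ <;> rw [h]
    · have h := doublingBranch.antitoneOn_op hf.anti_right
      rw [doublingBranch_range] at h
      refine h.mono ?_
      rcases hS with rfl | rfl
      · exact Ioc_subset_Ioc_right (by norm_num)
      · exact Ioc_subset_Ioc_left (by norm_num)
    · rcases hS with rfl | rfl
      · intro x hx y hy _
        rw [Branch.op_of_notMem _ (x := y)]
        · exact zero_le
        · rw [contractingBranch_range]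
          exact fun h' => not_lt.2 hy.2 h'.1
      · have h := (contractingBranch K hK).antitoneOn_op hf.anti_right
        rwa [contractingBranch_range] at h
  intro x hx y hy hxy
  refine Finset.sum_le_sum fun j _ => ?_
  gcongr
  · exact hleft j hx hy hxy
  · exact hright j hx hy hxy

theorem op_le_left (hf : s.Admissible A B M f) (hA : 0 ≤ A) (hB : 0 ≤ B) {γ : ℝ}
    (hγ : ∀ x ∈ Ioc (0 : ℝ) 1,
      ∑ j, s.p j * ((s.left j).Y x ^ (-s.αmin) * ((s.left j).D ((s.left j).Y x))⁻¹) ≤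
        x ^ (-s.αmin) - γ)
    (hAB : B ≤ γ * A) {x : ℝ} (hx : x ∈ Ioc (0 : ℝ) (1 / 2)) :
    s.op f x ≤ ENNReal.ofReal (A * x ^ (-s.αmin)) := by
  have hx' : x ∈ Ioc (0 : ℝ) 1 := ⟨hx.1, by linarith [hx.2]⟩
  have hYpos : ∀ j, 0 ≤ (s.left j).Y x ^ (-s.αmin) := fun j =>
    Real.rpow_nonneg (s.left_mem hx').1.le _
  have hDpos : ∀ j, 0 ≤ ((s.left j).D ((s.left j).Y x))⁻¹ := fun j =>
    inv_nonneg.2 (zero_le_one.trans (s.one_le_left_D (s.left_mem hx').1))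
  have hnn : ∀ j, 0 ≤ A * ((s.left j).Y x ^ (-s.αmin) * ((s.left j).D ((s.left j).Y x))⁻¹) + B :=
    fun j => add_nonneg (mul_nonneg hA (mul_nonneg (hYpos j) (hDpos j))) hB
  calc s.op f x ≤ ∑ j, ENNReal.ofReal (s.p j) * ENNReal.ofReal
        (A * ((s.left j).Y x ^ (-s.αmin) * ((s.left j).D ((s.left j).Y x))⁻¹) + B) := by
        refine Finset.sum_le_sum fun j _ => ?_
        rw [ENNReal.ofReal_add (mul_nonneg hA (mul_nonneg (hYpos j) (hDpos j))) hB, ← mul_assoc A,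
          ENNReal.ofReal_mul (mul_nonneg hA (hYpos j)), s.left_op hx']
        gcongr
        · exact hf.le_left _ (s.left_mem hx')
        · exact hf.right_op_le_of_le_half j hx
    _ = ENNReal.ofReal (∑ j, s.p j *
        (A * ((s.left j).Y x ^ (-s.αmin) * ((s.left j).D ((s.left j).Y x))⁻¹) + B)) := by
        rw [ENNReal.ofReal_sum_of_nonneg fun j _ => mul_nonneg (s.p_pos j).le (hnn j)]
        simp only [ENNReal.ofReal_mul (s.p_pos _).le]
    _ ≤ _ := by
        refine ENNReal.ofReal_le_ofReal ?_
        have h := mul_le_mul_of_nonneg_left (hγ x hx') hA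
        rw [Finset.mul_sum] at h
        simp only [mul_add, Finset.sum_add_distrib, ← Finset.sum_mul, s.p_sum, one_mul]
        calc _ = (∑ j, A * (s.p j *
              ((s.left j).Y x ^ (-s.αmin) * ((s.left j).D ((s.left j).Y x))⁻¹))) + B := by
              congr! 2
              ring
          _ ≤ _ := by nlinarith

theorem op_le_right (hf : s.Admissible A B M f) (hB : 0 ≤ B) (hM : 0 ≤ M)
    (hMB : 8 * M + (∑ j, s.p j * s.q j) * B ≤ B) {x : ℝ} (hx : x ∈ Ioc (1 / 2 : ℝ) 1) :
    s.op f x ≤ ENNReal.ofReal B := by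
  have hx' : x ∈ Ioc (0 : ℝ) 1 := ⟨by linarith [hx.1], hx.2⟩
  have hqB : ∀ j, 0 ≤ s.q j * B := fun j => mul_nonneg (s.q_nonneg j) hB
  calc s.op f x ≤ ∑ j, ENNReal.ofReal (s.p j) * ENNReal.ofReal (4 * M + (4 * M + s.q j * B)) := by
        refine Finset.sum_le_sum fun j _ => ?_
        rw [ENNReal.ofReal_add (by linarith) (by linarith [hqB j])]
        gcongr
        · have hu := s.left_mem (j := j) hx'
          rw [s.left_op hx']
          calc _ ≤ ENNReal.ofReal (4 * M) * ENNReal.ofReal 1 := by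
                gcongr
                · exact hf.le_of_quarter_le ⟨s.quarter_le_left_Y hx, hu.2⟩
                · exact inv_le_one_of_one_le₀ (s.one_le_left_D hu.1)
            _ = _ := by simp
        · exact hf.right_op_le hB hM j hx
    _ = ENNReal.ofReal (∑ j, s.p j * (4 * M + (4 * M + s.q j * B))) := by
        rw [ENNReal.ofReal_sum_of_nonneg fun j _ =>
          mul_nonneg (s.p_pos j).le (by linarith [hqB j])]
        simp only [ENNReal.ofReal_mul (s.p_pos _).le]
    _ ≤ _ := by
        refine ENNReal.ofReal_le_ofReal (le_trans (le_of_eq ?_) hMB)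
        simp only [mul_add, Finset.sum_add_distrib, ← Finset.sum_mul, s.p_sum, ← mul_assoc]
        ring

end Admissible

variable (s) in
/-- Parameters for which the class `Admissible A B M` is preserved by the transfer operator. -/
structure Preserved (A B M : ℝ) : Prop where
  A_nonneg : 0 ≤ A
  B_nonneg : 0 ≤ B
  M_nonneg : 0 ≤ M
  op : ∀ f, s.Admissible A B M f → s.Admissible A B M (s.op f)

theorem Preserved.iterate {A B M : ℝ} (h : s.Preserved A B M) {f : ℝ → ℝ≥0∞}
    (hf : s.Admissible A B M f) (n : ℕ) : s.Admissible A B M (s.op^[n] f) := by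
  induction n with
  | zero => exact hf
  | succ n ih => rw [Function.iterate_succ_apply']; exact h.op _ ih

variable (s) in
/-- Preserved classes exist with arbitrarily large bounds. -/
theorem exists_preserved (M B₀ : ℝ) (hM : 0 ≤ M) :
    ∃ A B, B₀ ≤ B ∧ B ≤ A ∧ s.Preserved A B M := by
  obtain ⟨γ, hγ0, hγ⟩ := s.exists_gap
  set κ := ∑ j, s.p j * s.q j with hκ
  have hκ1 : 0 < 1 - κ := sub_pos.2 s.sum_lt_one
  set B := max (max B₀ 0) (8 * M / (1 - κ)) with hBdef
  have hB : 0 ≤ B := (le_max_right _ _).trans (le_max_left _ _)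
  have hA : 0 ≤ B + B / γ := by positivity
  have hMB : 8 * M + κ * B ≤ B := by
    have : 8 * M / (1 - κ) ≤ B := le_max_right _ _
    rw [div_le_iff₀ hκ1] at this
    linarith
  have hAB : B ≤ γ * (B + B / γ) := by
    have : γ * (B / γ) = B := by field_simp
    nlinarith
  refine ⟨B + B / γ, B, (le_max_left _ _).trans (le_max_left _ _), ?_, hA, hB, hM, fun f hf => ?_⟩
  · have : 0 ≤ B / γ := by positivity
    linarith
  · exact ⟨s.measurable_op hf.meas, hf.antitoneOn_op_of_subset (Or.inl rfl),
      hf.antitoneOn_op_of_subset (Or.inr rfl), fun x hx => hf.op_le_left hA hB hγ hAB hx,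
      fun x hx => hf.op_le_right hB hM hMB hx, (s.lintegral_op hf.meas).trans_le hf.mass⟩

theorem exists_small_mass {α A B m : ℝ} (hα : α < 1) (hA : 0 ≤ A) (hm : 0 < m) :
    ∃ δ ∈ Ioc (0 : ℝ) (1 / 4), (∫⁻ x in Ioc 0 δ, ENNReal.ofReal (A * x ^ (-α))) ≤
      ENNReal.ofReal m ∧ B * δ ≤ m := by
  have h1 : Filter.Tendsto (fun δ : ℝ => A * (δ ^ (1 - α) / (1 - α))) (nhdsWithin 0 (Ioi 0))
      (nhds 0) := by
    have hc : ContinuousAt (fun δ : ℝ => A * (δ ^ (1 - α) / (1 - α))) 0 :=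
      continuousAt_const.mul ((Real.continuousAt_rpow_const _ _
        (Or.inr (by linarith))).div_const _)
    have h := hc.tendsto.mono_left (nhdsWithin_le_nhds (s := Ioi 0))
    simpa [Real.zero_rpow (sub_pos.2 hα).ne'] using h
  have h2 : Filter.Tendsto (fun δ : ℝ => B * δ) (nhdsWithin 0 (Ioi 0)) (nhds 0) := by
    have hc : ContinuousAt (fun δ : ℝ => B * δ) 0 := by fun_prop
    simpa using hc.tendsto.mono_left (nhdsWithin_le_nhds (s := Ioi 0))
  have h3 : ∀ᶠ δ : ℝ in nhdsWithin 0 (Ioi 0), δ ∈ Ioc (0 : ℝ) (1 / 4) :=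
    Ioc_mem_nhdsGT (by norm_num)
  obtain ⟨δ, hδ1, hδ2, hδ⟩ :=
    ((h1.eventually (Iic_mem_nhds hm)).and ((h2.eventually (Iic_mem_nhds hm)).and h3)).exists
  refine ⟨δ, hδ, ?_, hδ2⟩
  have hint : IntervalIntegrable (fun x : ℝ => A * x ^ (-α)) volume 0 δ :=
    (intervalIntegral.intervalIntegrable_rpow' (by linarith)).const_mul A
  rw [intervalIntegrable_iff_integrableOn_Ioc_of_le hδ.1.le] at hint
  rw [← ofReal_integral_eq_lintegral_ofReal hint ((ae_restrict_iff' measurableSet_Ioc).2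
    (Filter.Eventually.of_forall fun x hx => mul_nonneg hA (Real.rpow_nonneg hx.1.le _))),
    ← intervalIntegral.integral_of_le hδ.1.le, intervalIntegral.integral_const_mul,
    integral_rpow (Or.inl (by linarith)), neg_add_eq_sub, Real.zero_rpow (by linarith), sub_zero]
  exact ENNReal.ofReal_le_ofReal hδ1

theorem _root_.AntitoneOn.setLIntegral_le {f : ℝ → ℝ≥0∞} {a b x : ℝ}
    (hf : AntitoneOn f (Ioc a b)) (hx : x ∈ Ioc a b) :
    ∫⁻ u in Ioc x b, f u ≤ f x * ENNReal.ofReal (b - x) := by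
  calc ∫⁻ u in Ioc x b, f u ≤ ∫⁻ _ in Ioc x b, f x := setLIntegral_mono' measurableSet_Ioc
        fun u hu => hf hx ⟨hx.1.trans hu.1, hu.2⟩ hu.1.le
    _ = _ := by rw [setLIntegral_const, Real.volume_Ioc]

variable (s) in
/-- After one step, an admissible function of definite mass is bounded below near `0`. -/
theorem exists_lower_bound_near_zero {A B M m : ℝ} (hA : 0 ≤ A) (hm : 0 < m) :
    ∃ δ ∈ Ioc (0 : ℝ) (1 / 2), ∃ ε > (0 : ℝ), ∀ f, s.Admissible A B M f →
      ENNReal.ofReal m ≤ ∫⁻ x in Ioc 0 1, f x →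
      ∀ x ∈ Ioc (0 : ℝ) δ, ENNReal.ofReal ε ≤ s.op f x := by
  obtain ⟨δ, hδ, hδA, hδB⟩ := exists_small_mass (B := B) s.αmin_lt_one hA
    (by positivity : 0 < m / 4)
  obtain ⟨i, hi⟩ := s.exists_full
  have hαi := s.α_pos i
  have hpi := s.p_pos i
  have hδ0 := hδ.1
  have hδ1 := hδ.2
  refine ⟨δ, ⟨hδ0, by linarith⟩, s.p i * (m * (2 + s.α i)⁻¹), by positivity, fun f hf hmf => ?_⟩
  have hsum : ENNReal.ofReal m ≤ f δ + f (1 / 2 + δ) := by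
    have h1 : ∫⁻ u in Ioc 0 δ, f u ≤ ENNReal.ofReal (m / 4) :=
      (setLIntegral_mono' measurableSet_Ioc fun u hu =>
        hf.le_left u ⟨hu.1, by linarith [hu.2]⟩).trans hδA
    have h2 : ∫⁻ u in Ioc δ (1 / 2), f u ≤ f δ * ENNReal.ofReal (1 / 2) :=
      (hf.anti_left.setLIntegral_le ⟨hδ0, by linarith⟩).trans (by gcongr; linarith)
    have h3 : ∫⁻ u in Ioc (1 / 2) (1 / 2 + δ), f u ≤ ENNReal.ofReal (m / 4) := by
      calc _ ≤ ∫⁻ _ in Ioc (1 / 2) (1 / 2 + δ), ENNReal.ofReal B :=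
            setLIntegral_mono' measurableSet_Ioc fun u hu =>
              hf.le_right u ⟨hu.1, by linarith [hu.2]⟩
        _ = ENNReal.ofReal (B * δ) := by
            rw [setLIntegral_const, Real.volume_Ioc, add_sub_cancel_left,
              ENNReal.ofReal_mul' hδ0.le]
        _ ≤ _ := ENNReal.ofReal_le_ofReal hδB
    have h4 : ∫⁻ u in Ioc (1 / 2 + δ) 1, f u ≤ f (1 / 2 + δ) * ENNReal.ofReal (1 / 2) :=
      (hf.anti_right.setLIntegral_le ⟨by linarith, by linarith⟩).trans (by gcongr; linarith)
    have hsplit : ∫⁻ u in Ioc 0 1, f u = (∫⁻ u in Ioc 0 δ, f u) + (∫⁻ u in Ioc δ (1 / 2), f u) +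
        (∫⁻ u in Ioc (1 / 2) (1 / 2 + δ), f u) + ∫⁻ u in Ioc (1 / 2 + δ) 1, f u := by
      rw [← lintegral_union measurableSet_Ioc (Ioc_disjoint_Ioc_of_le le_rfl),
        Ioc_union_Ioc_eq_Ioc hδ0.le (by linarith),
        ← lintegral_union measurableSet_Ioc (Ioc_disjoint_Ioc_of_le le_rfl),
        Ioc_union_Ioc_eq_Ioc (by norm_num) (by linarith),
        ← lintegral_union measurableSet_Ioc (Ioc_disjoint_Ioc_of_le le_rfl),
        Ioc_union_Ioc_eq_Ioc (by linarith) (by linarith)]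
    have htot : ENNReal.ofReal (m / 2) + ENNReal.ofReal (m / 2) ≤
        (f δ + f (1 / 2 + δ)) * ENNReal.ofReal (1 / 2) + ENNReal.ofReal (m / 2) := by
      calc _ = ENNReal.ofReal m := by
            rw [← ENNReal.ofReal_add (by positivity) (by positivity), add_halves]
        _ ≤ _ := hmf
        _ ≤ ENNReal.ofReal (m / 4) + f δ * ENNReal.ofReal (1 / 2) + ENNReal.ofReal (m / 4) +
            f (1 / 2 + δ) * ENNReal.ofReal (1 / 2) := by
            rw [hsplit]
            gcongr
        _ = (f δ + f (1 / 2 + δ)) * ENNReal.ofReal (1 / 2) +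
            (ENNReal.ofReal (m / 4) + ENNReal.ofReal (m / 4)) := by ring
        _ = _ := by
            rw [← ENNReal.ofReal_add (by positivity) (by positivity)]
            congr 2
            ring
    have hhalf := (ENNReal.add_le_add_iff_right ENNReal.ofReal_ne_top).1 htot
    calc ENNReal.ofReal m = ENNReal.ofReal (m / 2) * ENNReal.ofReal 2 := by
          rw [← ENNReal.ofReal_mul (by positivity)]
          congr 1
          ring
      _ ≤ (f δ + f (1 / 2 + δ)) * ENNReal.ofReal (1 / 2) * ENNReal.ofReal 2 := by gcongr
      _ = _ := by
          rw [mul_assoc, ← ENNReal.ofReal_mul (by norm_num)]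
          norm_num
  intro x hx
  have hx' : x ∈ Ioc (0 : ℝ) 1 := ⟨hx.1, by linarith [hx.2]⟩
  have hu := s.left_mem (j := i) hx'
  calc ENNReal.ofReal (s.p i * (m * (2 + s.α i)⁻¹)) =
        ENNReal.ofReal (s.p i) * (ENNReal.ofReal m * ENNReal.ofReal (2 + s.α i)⁻¹) := by
        rw [ENNReal.ofReal_mul hpi.le, ENNReal.ofReal_mul hm.le]
    _ ≤ ENNReal.ofReal (s.p i) * ((f δ + f (1 / 2 + δ)) * ENNReal.ofReal (2 + s.α i)⁻¹) := by
        gcongr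
    _ ≤ ENNReal.ofReal (s.p i) * ((s.left i).op f x + (s.right i).op f x) := by
        rw [hi, doublingBranch_op hx', s.left_op hx', add_mul]
        gcongr
        · exact hf.anti_left hu ⟨hδ0, by linarith⟩ ((s.left_Y_le hx').trans hx.2)
        · exact zero_lt_one.trans_le (s.one_le_left_D hu.1)
        · exact s.left_D_le hu
        · exact hf.anti_right ⟨by linarith [hx.1], by linarith [hx.2]⟩
            ⟨by linarith, by linarith⟩ (by linarith [hx.2])
        · linarith
    _ ≤ _ := Finset.single_le_sum
        (f := fun j => ENNReal.ofReal (s.p j) * ((s.left j).op f x + (s.right j).op f x))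
        (fun _ _ => zero_le) (Finset.mem_univ i)

variable (s) in
/-- A lower bound on `(0, δ]` is propagated by the left branches to `(0, L δ]`. -/
theorem lower_bound_op (i : ι) {f : ℝ → ℝ≥0∞} {δ ε : ℝ} (hδ : δ ∈ Ioc (0 : ℝ) (1 / 2))
    (hε : 0 < ε) (hf : ∀ x ∈ Ioc (0 : ℝ) δ, ENNReal.ofReal ε ≤ f x) {x : ℝ}
    (hx : x ∈ Ioc (0 : ℝ) 1) (hxδ : x ≤ lsvLeft (s.α i) δ) :
    ENNReal.ofReal (s.p i * (ε * (2 + s.α i)⁻¹)) ≤ s.op f x := by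
  have hu := s.left_mem (j := i) hx
  have huδ : (s.left i).Y x ≤ δ := by
    have h1 : (s.left i).Y (lsvLeft (s.α i) δ) = δ := (s.left i).Y_L δ hδ
    rw [← h1]
    exact (s.left i).Y_mono hxδ
  calc ENNReal.ofReal (s.p i * (ε * (2 + s.α i)⁻¹)) =
        ENNReal.ofReal (s.p i) * (ENNReal.ofReal ε * ENNReal.ofReal (2 + s.α i)⁻¹) := by
        rw [ENNReal.ofReal_mul (s.p_pos i).le, ENNReal.ofReal_mul hε.le]
    _ ≤ ENNReal.ofReal (s.p i) * ((s.left i).op f x + (s.right i).op f x) := by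
        rw [s.left_op hx]
        refine mul_le_mul_right (le_add_right ?_) _
        gcongr
        · exact hf _ ⟨hu.1, huδ⟩
        · exact zero_lt_one.trans_le (s.one_le_left_D hu.1)
        · exact s.left_D_le hu
    _ ≤ _ := Finset.single_le_sum
        (f := fun j => ENNReal.ofReal (s.p j) * ((s.left j).op f x + (s.right j).op f x))
        (fun _ _ => zero_le) (Finset.mem_univ i)

variable (s) in
theorem exists_iterate_lower_bound {δ ε : ℝ} (hδ : δ ∈ Ioc (0 : ℝ) (1 / 2)) (hε : 0 < ε) :
    ∃ n : ℕ, ∃ c > (0 : ℝ), ∀ f : ℝ → ℝ≥0∞, (∀ x ∈ Ioc (0 : ℝ) δ, ENNReal.ofReal ε ≤ f x) →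
      ∀ x ∈ Ioc (0 : ℝ) 1, ENNReal.ofReal c ≤ s.op^[n] f x := by
  obtain ⟨i, -⟩ := s.exists_full
  have hαi := s.α_pos i
  have hpi := s.p_pos i
  have hδ0 := hδ.1
  set ρ : ℝ := 2 ^ s.α i * δ ^ s.α i with hρ
  have hρ0 : 0 < ρ := by positivity
  have hgrow : ∀ n : ℕ, ∃ c > (0 : ℝ), ∀ f : ℝ → ℝ≥0∞,
      (∀ x ∈ Ioc (0 : ℝ) δ, ENNReal.ofReal ε ≤ f x) →
      ∀ x ∈ Ioc (0 : ℝ) (min (1 / 2) (δ * (1 + ρ) ^ n)), ENNReal.ofReal c ≤ s.op^[n] f x := by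
    intro n
    induction n with
    | zero =>
      refine ⟨ε, hε, fun f hf x hx => hf x ⟨hx.1, ?_⟩⟩
      simpa using hx.2.trans (min_le_right _ _)
    | succ n ih =>
      obtain ⟨c, hc, hcf⟩ := ih
      refine ⟨s.p i * (c * (2 + s.α i)⁻¹), by positivity, fun f hf x hx => ?_⟩
      rw [Function.iterate_succ_apply']
      have hx1 : x ≤ 1 / 2 := hx.2.trans (min_le_left _ _)
      have hx2 : x ≤ δ * (1 + ρ) ^ (n + 1) := hx.2.trans (min_le_right _ _)
      have hpow : δ ≤ δ * (1 + ρ) ^ n :=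
        le_mul_of_one_le_right hδ0.le (one_le_pow₀ (by linarith))
      have hmin : δ ≤ min (1 / 2) (δ * (1 + ρ) ^ n) := le_min hδ.2 hpow
      refine s.lower_bound_op i ⟨hδ0.trans_le hmin, min_le_left _ _⟩ hc (hcf f hf)
        ⟨hx.1, by linarith⟩ ?_
      have hL : min (1 / 2) (δ * (1 + ρ) ^ n) * (1 + ρ) ≤
          lsvLeft (s.α i) (min (1 / 2) (δ * (1 + ρ) ^ n)) := by
        unfold lsvLeft
        rw [hρ]
        gcongr
      refine le_trans ?_ hL
      rw [min_mul_of_nonneg _ _ (by linarith : 0 ≤ 1 + ρ)]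
      refine le_min (by linarith) ?_
      rwa [mul_assoc, ← pow_succ]
  obtain ⟨n, hn⟩ := pow_unbounded_of_one_lt (1 / 2 / δ) (by linarith : 1 < 1 + ρ)
  obtain ⟨c, hc, hcf⟩ := hgrow n
  refine ⟨n + 1, s.p i * (c * (2 + s.α i)⁻¹), by positivity, fun f hf x hx => ?_⟩
  rw [Function.iterate_succ_apply']
  rw [div_lt_iff₀ hδ0] at hn
  refine s.lower_bound_op i ⟨by norm_num, le_rfl⟩ hc (fun y hy => hcf f hf y ⟨hy.1, ?_⟩) hx
    (by rw [lsvLeft_half]; exact hx.2)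
  exact le_min hy.2 (by linarith [hy.2])

variable (s) in
/-- A uniform minorization for admissible functions of definite mass. -/
theorem exists_minorization {A B M m : ℝ} (hP : s.Preserved A B M) (hm : 0 < m) :
    ∃ n : ℕ, ∃ c > (0 : ℝ), ∀ f, s.Admissible A B M f →
      ENNReal.ofReal m ≤ ∫⁻ x in Ioc 0 1, f x →
      ∀ x ∈ Ioc (0 : ℝ) 1, ENNReal.ofReal c ≤ s.op^[n] f x := by
  obtain ⟨δ, hδ, ε, hε, h1⟩ := s.exists_lower_bound_near_zero (B := B) (M := M) hP.A_nonneg hm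
  obtain ⟨n, c, hc, h2⟩ := s.exists_iterate_lower_bound hδ hε
  refine ⟨n + 1, c, hc, fun f hf hmf x hx => ?_⟩
  rw [Function.iterate_succ_apply]
  exact h2 _ (h1 f hf hmf) x hx

theorem Admissible.sub_const {A B M c : ℝ} {f : ℝ → ℝ≥0∞} (hf : s.Admissible A B M f) :
    s.Admissible A B M fun x => f x - ENNReal.ofReal c where
  meas := hf.meas.sub_const _
  anti_left _ hx _ hy hxy := tsub_le_tsub_right (hf.anti_left hx hy hxy) _
  anti_right _ hx _ hy hxy := tsub_le_tsub_right (hf.anti_right hx hy hxy) _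
  le_left x hx := tsub_le_self.trans (hf.le_left x hx)
  le_right x hx := tsub_le_self.trans (hf.le_right x hx)
  mass := (lintegral_mono fun _ => tsub_le_self).trans hf.mass

/-- Coupling: the iterates of admissible functions of equal mass agree up to admissible errors of
arbitrarily small mass. -/
theorem Preserved.exists_coupling {A B M m : ℝ} (hP : s.Preserved A B M) (hm : 0 < m)
    {g h : ℝ → ℝ≥0∞} (hg : s.Admissible A B M g) (hh : s.Admissible A B M h)
    (hgh : ∫⁻ x in Ioc 0 1, g x = ∫⁻ x in Ioc 0 1, h x) :
    ∃ (n : ℕ) (g' h' : ℝ → ℝ≥0∞), Measurable g' ∧ ∫⁻ x in Ioc 0 1, g' x ≤ ENNReal.ofReal m ∧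
      ∀ x ∈ Ioc (0 : ℝ) 1, s.op^[n] g x + h' x = s.op^[n] h x + g' x := by
  obtain ⟨n₀, c, hc, hmin⟩ := s.exists_minorization hP hm
  have key : ∀ k : ℕ, ∃ (n : ℕ) (g' h' : ℝ → ℝ≥0∞), s.Admissible A B M g' ∧
      s.Admissible A B M h' ∧ ∫⁻ x in Ioc 0 1, g' x = ∫⁻ x in Ioc 0 1, h' x ∧
      (∫⁻ x in Ioc 0 1, g' x ≤ ENNReal.ofReal m ∨
        (∫⁻ x in Ioc 0 1, g' x) + k * ENNReal.ofReal c ≤ ENNReal.ofReal M) ∧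
      ∀ x ∈ Ioc (0 : ℝ) 1, s.op^[n] g x + h' x = s.op^[n] h x + g' x := by
    intro k
    induction k with
    | zero =>
      refine ⟨0, g, h, hg, hh, hgh, Or.inr ?_, fun x _ => add_comm _ _⟩
      simpa using hg.mass
    | succ k ih =>
      obtain ⟨n, g', h', hg', hh', heq, hmass, hrel⟩ := ih
      by_cases hsmall : ∫⁻ x in Ioc 0 1, g' x ≤ ENNReal.ofReal m
      · exact ⟨n, g', h', hg', hh', heq, Or.inl hsmall, hrel⟩
      have hgmin := hmin g' hg' (not_le.1 hsmall).le
      have hhmin := hmin h' hh' (heq ▸ (not_le.1 hsmall).le)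
      have hint : ∀ {f : ℝ → ℝ≥0∞}, s.Admissible A B M f →
          (∀ x ∈ Ioc (0 : ℝ) 1, ENNReal.ofReal c ≤ s.op^[n₀] f x) →
          (∫⁻ x in Ioc 0 1, (s.op^[n₀] f x - ENNReal.ofReal c)) + ENNReal.ofReal c =
            ∫⁻ x in Ioc 0 1, f x := by
        intro f hf hfmin
        rw [← s.lintegral_iterate_op hf.meas n₀]
        have hconst : ∫⁻ _ in Ioc (0 : ℝ) 1, ENNReal.ofReal c = ENNReal.ofReal c := by
          rw [setLIntegral_const, Real.volume_Ioc]; simp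
        nth_rewrite 2 [← hconst]
        rw [← lintegral_add_right _ measurable_const]
        exact setLIntegral_congr_fun measurableSet_Ioc fun x hx => tsub_add_cancel_of_le (hfmin x hx)
      have hgi := hint hg' hgmin
      have hhi := hint hh' hhmin
      refine ⟨n₀ + n, fun x => s.op^[n₀] g' x - ENNReal.ofReal c,
        fun x => s.op^[n₀] h' x - ENNReal.ofReal c, (hP.iterate hg' n₀).sub_const,
        (hP.iterate hh' n₀).sub_const, ?_, Or.inr ?_, fun x hx => ?_⟩
      · rw [← heq, ← hgi] at hhi
        exact ((ENNReal.add_left_inj ENNReal.ofReal_ne_top).1 hhi).symm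
      · have hM := hmass.resolve_left hsmall
        rw [← hgi] at hM
        refine le_trans (le_of_eq ?_) hM
        push_cast
        ring
      · have h1 := s.iterate_op_congr hrel n₀ x hx
        rw [s.iterate_op_add, s.iterate_op_add] at h1
        dsimp only at h1
        rw [← Function.iterate_add_apply,
          ← Function.iterate_add_apply, ← tsub_add_cancel_of_le (hgmin x hx),
          ← tsub_add_cancel_of_le (hhmin x hx), ← add_assoc, ← add_assoc] at h1
        exact (ENNReal.add_left_inj ENNReal.ofReal_ne_top).1 h1
  obtain ⟨k, hk⟩ := exists_nat_gt (M / c)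
  obtain ⟨n, g', h', hg', -, -, hmass, hrel⟩ := key k
  refine ⟨n, g', h', hg'.meas, hmass.resolve_right fun hle => ?_, hrel⟩
  rw [div_lt_iff₀ hc] at hk
  have h1 : (k : ℝ≥0∞) * ENNReal.ofReal c ≤ ENNReal.ofReal M := le_add_self.trans hle
  rw [← ENNReal.ofReal_natCast, ← ENNReal.ofReal_mul (by positivity),
    ENNReal.ofReal_le_ofReal_iff hP.M_nonneg] at h1
  linarith

variable (s) in
theorem admissible_ofReal {A B M : ℝ} {f : ℝ → ℝ} (hBA : B ≤ A) (hB : 0 ≤ B) (hf : Measurable f)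
    (hanti : AntitoneOn f (Ioc 0 1)) (hfB : ∀ x ∈ Ioc (0 : ℝ) 1, f x ≤ B)
    (hfM : ∀ x ∈ Ioc (0 : ℝ) 1, f x ≤ M) :
    s.Admissible A B M fun x => ENNReal.ofReal (f x) where
  meas := hf.ennreal_ofReal
  anti_left x hx y hy hxy := ENNReal.ofReal_le_ofReal
    (hanti ⟨hx.1, by linarith [hx.2]⟩ ⟨hy.1, by linarith [hy.2]⟩ hxy)
  anti_right x hx y hy hxy := ENNReal.ofReal_le_ofReal
    (hanti ⟨by linarith [hx.1], hx.2⟩ ⟨by linarith [hy.1], hy.2⟩ hxy)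
  le_left x hx := by
    have hx1 : x ≤ 1 := by linarith [hx.2]
    have h1 : 1 ≤ x ^ (-s.αmin) :=
      Real.one_le_rpow_of_pos_of_le_one_of_nonpos hx.1 hx1 (by linarith [s.αmin_pos])
    refine ENNReal.ofReal_le_ofReal ((hfB x ⟨hx.1, hx1⟩).trans ?_)
    nlinarith
  le_right x hx := ENNReal.ofReal_le_ofReal (hfB x ⟨by linarith [hx.1], hx.2⟩)
  mass := by
    calc ∫⁻ x in Ioc 0 1, ENNReal.ofReal (f x) ≤ ∫⁻ _ in Ioc (0 : ℝ) 1, ENNReal.ofReal M :=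
          setLIntegral_mono' measurableSet_Ioc fun x hx => ENNReal.ofReal_le_ofReal (hfM x hx)
      _ = _ := by rw [setLIntegral_const, Real.volume_Ioc]; simp

theorem Admissible.le_rpow {A B M : ℝ} {f : ℝ → ℝ≥0∞} (hf : s.Admissible A B M f) (hA : 0 ≤ A)
    (hBA : B ≤ A) {x : ℝ} (hx : x ∈ Ioc (0 : ℝ) 1) :
    f x ≤ ENNReal.ofReal (A * x ^ (-s.αmin)) := by
  rcases le_or_gt x (1 / 2) with h | h
  · exact hf.le_left x ⟨hx.1, h⟩
  · refine (hf.le_right x ⟨h, hx.2⟩).trans (ENNReal.ofReal_le_ofReal (hBA.trans ?_))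
    exact le_mul_of_one_le_right hA
      (Real.one_le_rpow_of_pos_of_le_one_of_nonpos hx.1 hx.2 (by linarith [s.αmin_pos]))

/-- A nonnegative integrable function on the unit interval is, up to a small error in `L¹`, bounded
by a difference of two bounded nonincreasing functions. -/
theorem exists_antitone_approx {f : ℝ → ℝ≥0∞} (hf : Measurable f)
    (hf1 : ∫⁻ x in Ioc 0 1, f x = 1) {ε : ℝ} (hε : 0 < ε) (hε1 : ε ≤ 1) :
    ∃ (h₁ h₂ : ℝ → ℝ) (c : ℝ) (e : ℝ → ℝ≥0∞), Measurable h₁ ∧ Measurable h₂ ∧ Measurable e ∧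
      AntitoneOn h₁ (Ioc 0 1) ∧ AntitoneOn h₂ (Ioc 0 1) ∧
      (∀ x ∈ Ioc (0 : ℝ) 1, 0 ≤ h₁ x ∧ h₁ x ≤ c) ∧ (∀ x ∈ Ioc (0 : ℝ) 1, 0 ≤ h₂ x ∧ h₂ x ≤ c) ∧
      (∃ σ ∈ Icc (0 : ℝ) 2, ∫⁻ x in Ioc 0 1, ENNReal.ofReal (h₁ x) =
        ∫⁻ x in Ioc 0 1, (ENNReal.ofReal (h₂ x) + ENNReal.ofReal σ)) ∧
      ∫⁻ x in Ioc 0 1, e x ≤ ENNReal.ofReal ε ∧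
      ∀ᵐ x ∂volume.restrict (Ioc 0 1),
        f x + ENNReal.ofReal (h₂ x) ≤ ENNReal.ofReal (h₁ x) + e x := by
  have hfin : ∀ᵐ x ∂volume.restrict (Ioc (0 : ℝ) 1), f x < ∞ :=
    ae_lt_top hf (by rw [hf1]; exact ENNReal.one_ne_top)
  set F : ℝ → ℝ := fun x => (f x).toReal with hF
  have hFint : IntegrableOn F (Ioc 0 1) :=
    integrable_toReal_of_lintegral_ne_top hf.aemeasurable (by rw [hf1]; exact ENNReal.one_ne_top)
  have hF1 : ∫ x in Ioc 0 1, F x = 1 := by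
    rw [hF, integral_toReal hf.aemeasurable hfin, hf1, ENNReal.toReal_one]
  obtain ⟨φ, -, hφ, hφc, -⟩ :=
    Integrable.exists_hasCompactSupport_integral_sub_le hFint (half_pos hε)
  obtain ⟨P, hP⟩ := exists_polynomial_near_of_continuousOn 0 1 φ hφc.continuousOn _ (half_pos hε)
  have hPc : Continuous fun x => P.eval x := P.continuous
  have hPint : IntegrableOn (fun x => P.eval x) (Ioc 0 1) :=
    (hPc.continuousOn.integrableOn_Icc).mono_set Ioc_subset_Icc_self
  have hφint : IntegrableOn φ (Ioc 0 1) :=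
    (hφc.continuousOn.integrableOn_Icc).mono_set Ioc_subset_Icc_self
  have herr : ∫ x in Ioc 0 1, |F x - P.eval x| ≤ ε := by
    have h1 : ∫ x in Ioc 0 1, |φ x - P.eval x| ≤ ε / 2 := by
      calc _ ≤ ∫ _ in Ioc (0 : ℝ) 1, ε / 2 :=
            setIntegral_mono_on (hφint.sub hPint).abs (by simp) measurableSet_Ioc fun x hx => by
              change |φ x - P.eval x| ≤ ε / 2
              rw [abs_sub_comm]
              exact (hP x (Ioc_subset_Icc_self hx)).le
        _ = _ := by simp
    calc _ ≤ ∫ x in Ioc 0 1, (|F x - φ x| + |φ x - P.eval x|) :=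
          setIntegral_mono_on (hFint.sub hPint).abs
            ((hFint.sub hφint).abs.add (hφint.sub hPint).abs) measurableSet_Ioc
            fun x _ => abs_sub_le _ _ _
      _ = (∫ x in Ioc 0 1, |F x - φ x|) + ∫ x in Ioc 0 1, |φ x - P.eval x| :=
          integral_add (hFint.sub hφint).abs (hφint.sub hPint).abs
      _ ≤ ε / 2 + ε / 2 := add_le_add hφ h1
      _ = ε := add_halves ε
  obtain ⟨b, hb⟩ := isCompact_Icc.exists_bound_of_continuousOn (s := Icc (0 : ℝ) 1)
    (f := fun x => P.eval x) hPc.continuousOn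
  obtain ⟨l, hl⟩ := isCompact_Icc.exists_bound_of_continuousOn (s := Icc (0 : ℝ) 1)
    (f := fun x => P.derivative.eval x) P.derivative.continuous.continuousOn
  have hb0 : 0 ≤ b := (norm_nonneg _).trans (hb 0 (left_mem_Icc.2 zero_le_one))
  have hl0 : 0 ≤ l := (norm_nonneg _).trans (hl 0 (left_mem_Icc.2 zero_le_one))
  have hbP : ∀ x ∈ Ioc (0 : ℝ) 1, -b ≤ P.eval x ∧ P.eval x ≤ b := fun x hx =>
    abs_le.1 (hb x (Ioc_subset_Icc_self hx))
  have hint : ∫ x in Ioc 0 1, P.eval x ∈ Icc (0 : ℝ) 2 := by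
    have h1 : |(∫ x in Ioc 0 1, F x) - ∫ x in Ioc 0 1, P.eval x| ≤ ε := by
      rw [← integral_sub hFint hPint]
      exact abs_integral_le_integral_abs.trans herr
    rw [hF1] at h1
    have := abs_le.1 h1
    constructor <;> linarith [this.1, this.2]
  set h₂ : ℝ → ℝ := fun x => b + l - l * x with hh₂
  have hh₂0 : ∀ x ∈ Ioc (0 : ℝ) 1, 0 ≤ h₂ x := fun x hx => by
    simp only [hh₂]
    nlinarith [hx.1, hx.2]
  have hh₁0 : ∀ x ∈ Ioc (0 : ℝ) 1, 0 ≤ P.eval x + h₂ x := fun x hx => by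
    simp only [hh₂]
    nlinarith [hx.1, hx.2, (hbP x hx).1]
  have hh₂int : IntegrableOn h₂ (Ioc 0 1) :=
    ((by fun_prop : Continuous h₂).continuousOn.integrableOn_Icc).mono_set Ioc_subset_Icc_self
  refine ⟨fun x => P.eval x + h₂ x, h₂, 2 * b + l, fun x => ENNReal.ofReal |F x - P.eval x|,
    by fun_prop, by fun_prop, ?_, ?_, ?_, ?_, ?_, ⟨∫ x in Ioc 0 1, P.eval x, hint, ?_⟩, ?_, ?_⟩
  · exact ((hf.ennreal_toReal.sub hPc.measurable).abs).ennreal_ofReal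
  · refine AntitoneOn.mono ?_ Ioc_subset_Icc_self
    have hd : ∀ x : ℝ, HasDerivAt (fun x => P.eval x + h₂ x) (P.derivative.eval x + -(l * 1)) x :=
      fun x => (P.hasDerivAt x).add (((hasDerivAt_id x).const_mul l).const_sub (b + l))
    refine antitoneOn_of_deriv_nonpos (convex_Icc 0 1)
      (fun x _ => (hd x).continuousAt.continuousWithinAt)
      (fun x _ => (hd x).differentiableAt.differentiableWithinAt) fun x hx => ?_
    rw [(hd x).deriv]
    have := (abs_le.1 (hl x (interior_subset hx))).2
    linarith
  · intro x _ y _ hxy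
    simp only [hh₂]
    gcongr
  · intro x hx
    refine ⟨hh₁0 x hx, ?_⟩
    simp only [hh₂]
    nlinarith [hx.1, (hbP x hx).2]
  · intro x hx
    refine ⟨hh₂0 x hx, ?_⟩
    simp only [hh₂]
    nlinarith [hx.1]
  · have hsum : IntegrableOn (fun x => P.eval x + h₂ x) (Ioc 0 1) := hPint.add hh₂int
    dsimp only
    rw [lintegral_add_right _ measurable_const, setLIntegral_const, Real.volume_Ioc,
      ← ofReal_integral_eq_lintegral_ofReal hsum
        ((ae_restrict_iff' measurableSet_Ioc).2 (Filter.Eventually.of_forall hh₁0)),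
      ← ofReal_integral_eq_lintegral_ofReal hh₂int
        ((ae_restrict_iff' measurableSet_Ioc).2 (Filter.Eventually.of_forall hh₂0)),
      integral_add hPint hh₂int, sub_zero, ENNReal.ofReal_one, mul_one, add_comm,
      ENNReal.ofReal_add (setIntegral_nonneg measurableSet_Ioc hh₂0) hint.1]
  · have habs : IntegrableOn (fun x => |F x - P.eval x|) (Ioc 0 1) := (hFint.sub hPint).abs
    dsimp only
    rw [← ofReal_integral_eq_lintegral_ofReal habs
      (Filter.Eventually.of_forall fun _ => abs_nonneg _)]
    exact ENNReal.ofReal_le_ofReal herr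
  · filter_upwards [hfin, ae_restrict_mem measurableSet_Ioc] with x hx hx1
    rw [← ENNReal.ofReal_toReal hx.ne, ← ENNReal.ofReal_add ENNReal.toReal_nonneg (hh₂0 x hx1),
      ← ENNReal.ofReal_add (hh₁0 x hx1) (abs_nonneg _)]
    refine ENNReal.ofReal_le_ofReal ?_
    linarith [le_abs_self (F x - P.eval x)]

variable (s) in
/-- Almost everywhere inequalities are preserved by the iterated transfer operator. -/
theorem iterate_op_mono_ae {f g : ℝ → ℝ≥0∞} (hf : Measurable f) (hg : Measurable g)
    (h : ∀ᵐ x ∂volume.restrict (Ioc 0 1), f x ≤ g x) (n : ℕ) :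
    ∀ᵐ x ∂volume.restrict (Ioc 0 1), s.op^[n] f x ≤ s.op^[n] g x := by
  have he : Measurable fun x => f x - g x := hf.sub hg
  have hzero : ∫⁻ x in Ioc 0 1, s.op^[n] (fun x => f x - g x) x = 0 := by
    rw [s.lintegral_iterate_op he, lintegral_eq_zero_iff he]
    filter_upwards [h] with x hx using tsub_eq_zero_of_le hx
  rw [lintegral_eq_zero_iff (s.measurable_iterate_op he n)] at hzero
  filter_upwards [hzero, ae_restrict_mem measurableSet_Ioc] with x hx0 hx
  calc s.op^[n] f x ≤ s.op^[n] (fun x => g x + (f x - g x)) x :=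
        s.iterate_op_mono (fun u _ => le_add_tsub) n x hx
    _ = s.op^[n] g x := by
        rw [s.iterate_op_add]
        simp only [Pi.zero_apply] at hx0
        simp only [hx0, add_zero]

variable (s) in
/-- Invariant densities are bounded by a multiple of `x ^ (-αmin)`. -/
theorem exists_density_bound {f : ℝ → ℝ≥0∞} (hf : Measurable f)
    (hf1 : ∫⁻ x in Ioc 0 1, f x = 1)
    (hfix : ∀ᵐ x ∂volume.restrict (Ioc 0 1), f x = s.op f x) :
    ∃ a > (0 : ℝ), ∀ᵐ x ∂volume.restrict (Ioc 0 1),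
      f x ≤ ENNReal.ofReal (a * x ^ (-s.αmin)) := by
  obtain ⟨A₀, B₀, hB₀, hBA₀, hP₀⟩ := s.exists_preserved 2 2 zero_le_two
  refine ⟨A₀, by linarith, ?_⟩
  set bound : ℝ → ℝ≥0∞ := fun x => ENNReal.ofReal (A₀ * x ^ (-s.αmin))
  have hbound : Measurable bound := by fun_prop
  suffices hsmall : ∀ ε : ℝ, 0 < ε → ε ≤ 1 →
      ∫⁻ x in Ioc 0 1, (f x - bound x) ≤ ENNReal.ofReal (2 * ε) by
    have hzero : ∫⁻ x in Ioc 0 1, (f x - bound x) = 0 := by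
      refine le_antisymm (ENNReal.le_of_forall_pos_le_add fun δ hδ _ => ?_) zero_le
      have hδ' : 0 < min (δ / 2 : ℝ) 1 := by positivity
      refine (hsmall _ hδ' (min_le_right _ _)).trans ?_
      rw [zero_add, ← ENNReal.ofReal_coe_nnreal]
      refine ENNReal.ofReal_le_ofReal ?_
      linarith [min_le_left (δ / 2 : ℝ) 1]
    have hm : Measurable fun x => f x - bound x := hf.sub hbound
    rw [lintegral_eq_zero_iff hm] at hzero
    filter_upwards [hzero] with x hx using tsub_eq_zero_iff_le.1 hx
  intro ε hε hε1
  obtain ⟨h₁, h₂, c, e, hm₁, hm₂, hme, ha₁, ha₂, hc₁, hc₂, ⟨σ, hσ, heq⟩, hemass, hle⟩ :=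
    exists_antitone_approx hf hf1 hε hε1
  have hc0 : 0 ≤ c := (hc₂ 1 (by simp)).1.trans (hc₂ 1 (by simp)).2
  obtain ⟨A, B, hB, hBA, hP⟩ := s.exists_preserved (c + 2) (c + 2) (by linarith)
  have hadm₁ : s.Admissible A B (c + 2) fun x => ENNReal.ofReal (h₁ x) :=
    s.admissible_ofReal hBA hP.B_nonneg hm₁ ha₁ (fun x hx => by linarith [(hc₁ x hx).2])
      (fun x hx => by linarith [(hc₁ x hx).2])
  have hadm₂ : s.Admissible A B (c + 2) fun x => ENNReal.ofReal (h₂ x) :=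
    s.admissible_ofReal hBA hP.B_nonneg hm₂ ha₂ (fun x hx => by linarith [(hc₂ x hx).2])
      (fun x hx => by linarith [(hc₂ x hx).2])
  have hadm₃ : s.Admissible A B (c + 2) fun x => ENNReal.ofReal (h₂ x + σ) :=
    s.admissible_ofReal hBA hP.B_nonneg (hm₂.add_const σ)
      (fun x hx y hy hxy => by have := ha₂ hx hy hxy; linarith)
      (fun x hx => by linarith [(hc₂ x hx).2, hσ.2])
      (fun x hx => by linarith [(hc₂ x hx).2, hσ.2])
  have hadm₀ : s.Admissible A₀ B₀ 2 fun _ => ENNReal.ofReal σ :=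
    s.admissible_ofReal hBA₀ hP₀.B_nonneg measurable_const (fun _ _ _ _ _ => le_rfl)
      (fun _ _ => hσ.2.trans hB₀) (fun _ _ => hσ.2)
  have hsplit : ∀ x ∈ Ioc (0 : ℝ) 1,
      ENNReal.ofReal (h₂ x + σ) = ENNReal.ofReal (h₂ x) + ENNReal.ofReal σ := fun x hx =>
    ENNReal.ofReal_add (hc₂ x hx).1 hσ.1
  obtain ⟨n, g', h', hg'm, hg', hrel⟩ := hP.exists_coupling hε hadm₁ hadm₃
    (heq.trans (setLIntegral_congr_fun measurableSet_Ioc fun x hx => (hsplit x hx).symm))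
  have hpt : ∀ᵐ x ∂volume.restrict (Ioc 0 1), f x - bound x ≤ g' x + s.op^[n] e x := by
    filter_upwards [s.iterate_op_ae_eq hf hfix n,
      s.iterate_op_mono_ae (hf.add hm₂.ennreal_ofReal) (hm₁.ennreal_ofReal.add hme) hle n,
      ae_restrict_mem measurableSet_Ioc] with x hx1 hx2 hx
    have h3 := s.iterate_op_congr hsplit n x hx
    have hrel := hrel x hx
    simp only [Pi.add_def, s.iterate_op_add] at hx2 h3
    rw [h3] at hrel
    have hfin : s.op^[n] (fun x => ENNReal.ofReal (h₂ x)) x ≠ ∞ :=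
      ne_top_of_le_ne_top ENNReal.ofReal_ne_top
        ((hP.iterate hadm₂ n).le_rpow hP.A_nonneg hBA hx)
    have hσx : s.op^[n] (fun _ => ENNReal.ofReal σ) x ≤ bound x :=
      (hP₀.iterate hadm₀ n).le_rpow hP₀.A_nonneg hBA₀ hx
    rw [tsub_le_iff_left]
    refine (ENNReal.add_le_add_iff_right hfin).1 ?_
    calc f x + s.op^[n] (fun x => ENNReal.ofReal (h₂ x)) x
        ≤ s.op^[n] f x + s.op^[n] (fun x => ENNReal.ofReal (h₂ x)) x := by gcongr
      _ ≤ s.op^[n] (fun x => ENNReal.ofReal (h₁ x)) x + s.op^[n] e x := hx2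
      _ ≤ s.op^[n] (fun x => ENNReal.ofReal (h₁ x)) x + h' x + s.op^[n] e x := by
          gcongr
          exact le_self_add
      _ = s.op^[n] (fun x => ENNReal.ofReal (h₂ x)) x + s.op^[n] (fun _ => ENNReal.ofReal σ) x +
          g' x + s.op^[n] e x := by rw [hrel]
      _ ≤ s.op^[n] (fun x => ENNReal.ofReal (h₂ x)) x + bound x + g' x + s.op^[n] e x := by
          gcongr
      _ = _ := by ring
  calc ∫⁻ x in Ioc 0 1, (f x - bound x) ≤ ∫⁻ x in Ioc 0 1, (g' x + s.op^[n] e x) :=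
        lintegral_mono_ae hpt
    _ = (∫⁻ x in Ioc 0 1, g' x) + ∫⁻ x in Ioc 0 1, e x := by
        rw [lintegral_add_left hg'm, s.lintegral_iterate_op hme]
    _ ≤ ENNReal.ofReal ε + ENNReal.ofReal ε := add_le_add hg' hemass
    _ = _ := by rw [← ENNReal.ofReal_add hε.le hε.le, two_mul]

variable (s) in
/-- Absolutely continuous stationary probability measures have a density bounded by a multiple of
`x ^ (-αmin)`. -/
theorem exists_bounded_density {T : ι → ℝ → ℝ}
    (hleft : ∀ j, ∀ u ≤ 1 / 2, T j u = lsvLeft (s.α j) u)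
    (hright : ∀ j, ∀ u > 1 / 2, T j u = (s.right j).L u)
    {μ : Measure ℝ} [IsProbabilityMeasure μ] (hac : μ ≪ volume.restrict (Icc (0 : ℝ) 1))
    (hstat : ∀ A : Set ℝ, MeasurableSet A → A ⊆ Icc (0 : ℝ) 1 →
      ∑ j, ENNReal.ofReal (s.p j) * μ (T j ⁻¹' A) = μ A) :
    ∃ g : ℝ → ℝ, μ = (volume.restrict (Icc (0 : ℝ) 1)).withDensity
        (fun x => ENNReal.ofReal (g x)) ∧
      ∃ a > (0 : ℝ), ∀ x ∈ Ioc (0 : ℝ) 1, g x ≤ a * x ^ (-s.αmin) := by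
  rw [← Measure.restrict_congr_set Ioc_ae_eq_Icc] at hac ⊢
  set lam : Measure ℝ := volume.restrict (Ioc (0 : ℝ) 1)
  set f := μ.rnDeriv lam
  have hf : Measurable f := Measure.measurable_rnDeriv μ lam
  have hdens : lam.withDensity f = μ := Measure.withDensity_rnDeriv_eq μ lam hac
  have hμ : ∀ S : Set ℝ, MeasurableSet S → S ⊆ Ioc 0 1 → μ S = ∫⁻ x in S, f x := fun S hS hS1 => by
    rw [← hdens, withDensity_apply _ hS, Measure.restrict_restrict hS, inter_eq_left.2 hS1]
  have hcompl : μ (Ioc (0 : ℝ) 1)ᶜ = 0 := hac (by simp [lam])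
  have hf1 : ∫⁻ x in Ioc 0 1, f x = 1 := by
    rw [← hμ _ measurableSet_Ioc subset_rfl, prob_compl_eq_zero_iff measurableSet_Ioc |>.1 hcompl]
  have hset : ∀ E : Set ℝ, MeasurableSet E → E ⊆ Ioc 0 1 →
      ∫⁻ x in E, f x = ∫⁻ x in E, s.op f x := fun E hE hE1 => by
    rw [s.setLIntegral_op hf hE, ← hμ E hE hE1, ← hstat E hE (hE1.trans Ioc_subset_Icc_self)]
    congr! 2 with j
    have hml : MeasurableSet (Ioc (0 : ℝ) (1 / 2) ∩ lsvLeft (s.α j) ⁻¹' E) :=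
      measurableSet_Ioc.inter ((s.left j).L_meas hE)
    have hmr : MeasurableSet (Ioc (1 / 2 : ℝ) 1 ∩ (s.right j).L ⁻¹' E) :=
      measurableSet_Ioc.inter ((s.right j).L_meas hE)
    have hdisj : Disjoint (Ioc (0 : ℝ) (1 / 2) ∩ lsvLeft (s.α j) ⁻¹' E)
        (Ioc (1 / 2 : ℝ) 1 ∩ (s.right j).L ⁻¹' E) :=
      (Ioc_disjoint_Ioc_of_le le_rfl).mono inter_subset_left inter_subset_left
    have hpre : T j ⁻¹' E ∩ Ioc 0 1 = (Ioc (0 : ℝ) (1 / 2) ∩ lsvLeft (s.α j) ⁻¹' E) ∪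
        (Ioc (1 / 2 : ℝ) 1 ∩ (s.right j).L ⁻¹' E) := by
      ext u
      simp only [mem_inter_iff, mem_union, mem_preimage, mem_Ioc]
      rcases le_or_gt u (1 / 2) with h | h
      · have h1 : u ≤ 1 := by linarith
        simp only [hleft j u h, h, h1, h.not_gt, and_true, false_and, or_false, and_comm]
      · have h0 : 0 < u := by linarith
        simp only [hright j u h, h, h0, h.not_ge, false_and, false_or, true_and, and_comm]
    rw [← measure_inter_conull hcompl, hpre, hμ _ (hml.union hmr), lintegral_union hmr hdisj]
    rw [← hpre]
    exact inter_subset_right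
  have hfix : ∀ᵐ x ∂lam, f x = s.op f x :=
    ae_eq_of_forall_setLIntegral_eq_of_sigmaFinite hf (s.measurable_op hf) fun E hE _ => by
      rw [Measure.restrict_restrict hE]
      exact hset _ (hE.inter measurableSet_Ioc) inter_subset_right
  obtain ⟨a, ha, hbound⟩ := s.exists_density_bound hf hf1 hfix
  refine ⟨fun x => min (f x).toReal (a * x ^ (-s.αmin)), ?_, a, ha, fun x _ => min_le_right _ _⟩
  rw [← hdens]
  refine withDensity_congr_ae ?_
  filter_upwards [hbound] with x hx
  rw [ENNReal.ofReal_min, ENNReal.ofReal_toReal (ne_top_of_le_ne_top ENNReal.ofReal_ne_top hx),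
    min_eq_left hx]

end BranchSystem

end

/-- If `∑_{r∈Σ_R} p_r K_r⁻¹ < 1` then the density of the unique acs probability
measure satisfies `dμ_p/dλ(x) ≤ a x^{-α_min}` on `(0,1]` for some `a > 0`. -/
theorem density_bound_of_sum_lt_one
    (N : ℕ) (hN : 0 < N)
    (α K : Fin N → ℝ) (SR : Finset (Fin N))
    (hSR : SR.Nonempty) (hSS : SRᶜ.Nonempty)
    (hα : ∀ j, 0 < α j)
    (hK : ∀ r ∈ SR, K r ∈ Set.Ioo (0 : ℝ) 1)
    (T : Fin N → ℝ → ℝ)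
    (hT : ∀ j, T j = if j ∈ SR then rMap (α j) (K j) else lsvMap (α j))
    (αmin : ℝ) (hαmin : IsLeast (Set.range α) αmin) (hαmin1 : αmin < 1)
    (p : Fin N → ℝ) (hp : ∀ j, 0 < p j) (hp1 : ∑ j, p j = 1)
    (hcond : ∑ r ∈ SR, p r * (K r)⁻¹ < 1)
    (μ : Measure ℝ) (hμprob : IsProbabilityMeasure μ)
    (hμac : μ ≪ volume.restrict (Set.Icc (0 : ℝ) 1))
    (hμstat : ∀ A : Set ℝ, MeasurableSet A → A ⊆ Set.Icc (0 : ℝ) 1 →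
      ∑ j, ENNReal.ofReal (p j) * μ (T j ⁻¹' A) = μ A) :
    ∃ g : ℝ → ℝ,
      μ = (volume.restrict (Set.Icc (0 : ℝ) 1)).withDensity
            (fun x => ENNReal.ofReal (g x)) ∧
      ∃ a > (0 : ℝ), ∀ x ∈ Set.Ioc (0 : ℝ) 1, g x ≤ a * x ^ (-αmin) := by
  let s : BranchSystem (Fin N) :=
    { p := p
      α := α
      q := fun j => if j ∈ SR then (K j)⁻¹ else 0
      right := fun j => if h : j ∈ SR then contractingBranch (K j) (hK j h) else doublingBranch
      αmin := αmin
      p_pos := hp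
      p_sum := hp1
      α_pos := hα
      q_nonneg := fun j => by
        split_ifs with h
        · exact inv_nonneg.2 (hK j h).1.le
        · exact le_rfl
      sum_lt_one := by simpa [Finset.sum_ite_mem] using hcond
      right_spec := fun j => by
        by_cases h : j ∈ SR
        · exact Or.inr ⟨K j, hK j h, if_pos h, dif_pos h⟩
        · exact Or.inl (dif_neg h)
      exists_full := hSS.imp fun j hj => dif_neg (Finset.mem_compl.1 hj)
      isLeast_αmin := hαmin
      αmin_lt_one := hαmin1 }
  refine s.exists_bounded_density (T := T) (fun j u hu => ?_) (fun j u hu => ?_) hμac hμstat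
  · rw [hT]
    split_ifs <;> exact if_pos hu
  · have hright : s.right j =
        if h : j ∈ SR then contractingBranch (K j) (hK j h) else doublingBranch := rfl
    rw [hT, hright]
    split_ifs <;> exact if_neg hu.not_ge
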